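/- arXiv:2010.15811 — 2 statements merged into one kernel-verified Lean document; each statement's English description precedes it below -/
import Mathlib

section
/- Let f : ℝ → ℝ be twice continuously differentiable with f′ and f″ bounded, and assume the fixed-point conditions α·E[f(√q̲·Z)²] = q̲ and α·E[f′(√q̲·Z)²] = 1. Then ψ(q̲) = q̲, the left derivative of ψ at q̲ equals 1, and ψ(t) ≥ t for all t ∈ [0, q̲]. If in addition f″ is not identically zero, then ψ(t) > t for every t ∈ [0, q̲). (Part of Lemma 3.3.) -/
open MeasureTheory ProbabilityTheory

/-- The standard Gaussian measure on `ℝ`. -/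
noncomputable def stdGauss : Measure ℝ := gaussianReal 0 1

/-- `ψ(t) = α·E[f(√t·Z + √(q̲−t)·Z′)·f(√t·Z + √(q̲−t)·Z″)]`, where `Z, Z′, Z″` are
i.i.d. standard Gaussians (realized as the three coordinates of the product measure). -/
noncomputable def psi (qlow α : ℝ) (f : ℝ → ℝ) (t : ℝ) : ℝ :=
  α * ∫ w : ℝ × ℝ × ℝ,
        f (Real.sqrt t * w.1 + Real.sqrt (qlow - t) * w.2.1) *
          f (Real.sqrt t * w.1 + Real.sqrt (qlow - t) * w.2.2)
      ∂(stdGauss.prod (stdGauss.prod stdGauss))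

open Filter Topology

/-- The standard Gaussian measure on `ℝ⁵`. -/
noncomputable abbrev gauss5 : Measure (Fin 5 → ℝ) := Measure.pi fun _ => stdGauss

instance : IsProbabilityMeasure stdGauss := by
  unfold stdGauss; infer_instance

instance : Measure.IsOpenPosMeasure stdGauss :=
  (gaussianReal_absolutelyContinuous' 0 one_ne_zero).isOpenPosMeasure

lemma memLp_id_stdGauss : MemLp (fun x : ℝ => x) 2 stdGauss :=
  memLp_id_gaussianReal 2

lemma memLp_eval_gauss5 (i : Fin 5) : MemLp (fun ω : Fin 5 → ℝ => ω i) 2 gauss5 :=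
  memLp_id_stdGauss.comp_measurePreserving
    (measurePreserving_eval (fun _ : Fin 5 => stdGauss) i)

lemma memLp_linear_gauss5 (a : Fin 5 → ℝ) :
    MemLp (fun ω : Fin 5 → ℝ => ∑ i, a i * ω i) 2 gauss5 :=
  memLp_finsetSum _ fun i _ => (memLp_eval_gauss5 i).const_mul (a i)

lemma abs_sub_le_of_deriv_bound {f : ℝ → ℝ} (hf : Differentiable ℝ f) {C : ℝ}
    (hC : ∀ x, |deriv f x| ≤ C) (x y : ℝ) : |f x - f y| ≤ C * |x - y| := by
  simpa using! Convex.norm_image_sub_le_of_norm_deriv_le (s := Set.univ)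
    (fun x _ => hf x) (fun x _ => hC x) convex_univ (Set.mem_univ y) (Set.mem_univ x)

lemma memLp_comp_linear_gauss5 {f : ℝ → ℝ} (hf : Differentiable ℝ f) {C : ℝ}
    (hC : ∀ x, |deriv f x| ≤ C) (a : Fin 5 → ℝ) :
    MemLp (fun ω : Fin 5 → ℝ => f (∑ i, a i * ω i)) 2 gauss5 := by
  have hc := hf.continuous
  have h : MemLp (fun ω : Fin 5 → ℝ => f (∑ i, a i * ω i) - f 0) 2 gauss5 := by
    refine (memLp_linear_gauss5 a).of_le_mul (c := C)
      (by fun_prop : Continuous _).aestronglyMeasurable (ae_of_all _ fun ω => ?_)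
    simpa using abs_sub_le_of_deriv_bound hf hC (∑ i, a i * ω i) 0
  exact (h.add (memLp_const (f 0))).congr_norm
    (by fun_prop : Continuous _).aestronglyMeasurable (ae_of_all _ fun ω => by simp)

lemma integral_cexp_linear_gauss5 (c : Fin 5 → ℝ) :
    ∫ ω : Fin 5 → ℝ, Complex.exp (((∑ i, c i * ω i : ℝ) : ℂ) * Complex.I) ∂gauss5
      = Complex.exp (-((∑ i, c i ^ 2 : ℝ) : ℂ) / 2) := by
  have h1 : ∀ ω : Fin 5 → ℝ, Complex.exp (((∑ i, c i * ω i : ℝ) : ℂ) * Complex.I)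
      = ∏ i, Complex.exp ((c i : ℂ) * (ω i : ℂ) * Complex.I) := by
    intro ω
    rw [← Complex.exp_sum]
    push_cast
    rw [Finset.sum_mul]
  simp_rw [h1]
  rw [integral_fintype_prod_eq_prod (𝕜 := ℂ)
    (f := fun (i : Fin 5) (x : ℝ) => Complex.exp ((c i : ℂ) * (x : ℂ) * Complex.I))]
  have h2 : ∀ i, ∫ x : ℝ, Complex.exp ((c i : ℂ) * (x : ℂ) * Complex.I) ∂stdGauss
      = Complex.exp (-(c i : ℂ) ^ 2 / 2) := by
    intro i
    rw [← charFun_apply_real, stdGauss, charFun_gaussianReal]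
    simp [neg_div]
  simp_rw [h2]
  rw [← Complex.exp_sum]
  push_cast
  rw [← Finset.sum_neg_distrib, Finset.sum_div]

/-- The joint law of two linear forms of a standard Gaussian vector depends only on their
covariance matrix. -/
lemma map_linear_pair_gauss5_eq {a b a' b' : Fin 5 → ℝ} (haa : ∑ i, a i ^ 2 = ∑ i, a' i ^ 2)
    (hbb : ∑ i, b i ^ 2 = ∑ i, b' i ^ 2) (hab : ∑ i, a i * b i = ∑ i, a' i * b' i) :
    gauss5.map (fun ω => (∑ i, a i * ω i, ∑ i, b i * ω i))
      = gauss5.map (fun ω => (∑ i, a' i * ω i, ∑ i, b' i * ω i)) := by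
  have key : ∀ (a b : Fin 5 → ℝ) (L : StrongDual ℝ (ℝ × ℝ)),
      charFunDual (gauss5.map (fun ω => (∑ i, a i * ω i, ∑ i, b i * ω i))) L
        = Complex.exp (-((L (1, 0) ^ 2 * ∑ i, a i ^ 2 + 2 * L (1, 0) * L (0, 1) * ∑ i, a i * b i
            + L (0, 1) ^ 2 * ∑ i, b i ^ 2 : ℝ) : ℂ) / 2) := by
    intro a b L
    have hL : ∀ x y : ℝ, L (x, y) = L (1, 0) * x + L (0, 1) * y := by
      intro x y
      have : (x, y) = x • ((1, 0) : ℝ × ℝ) + y • ((0, 1) : ℝ × ℝ) := by simp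
      rw [this, map_add, map_smul, map_smul]
      simp [mul_comm]
    have hcont : Continuous fun ω : Fin 5 → ℝ => (∑ i, a i * ω i, ∑ i, b i * ω i) := by
      fun_prop
    rw [charFunDual_apply, integral_map hcont.aemeasurable (by fun_prop)]
    have h := integral_cexp_linear_gauss5 (fun i => L (1, 0) * a i + L (0, 1) * b i)
    convert h using 2
    · ext ω
      rw [hL]
      congr 3
      simp only [Finset.mul_sum, ← Finset.sum_add_distrib]
      exact Finset.sum_congr rfl fun i _ => by ring
    · congr 3
      simp only [Finset.mul_sum, ← Finset.sum_add_distrib]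
      exact Finset.sum_congr rfl fun i _ => by ring
  have : ∀ a : Fin 5 → ℝ, ∀ b : Fin 5 → ℝ, IsFiniteMeasure
      (gauss5.map (fun ω => (∑ i, a i * ω i, ∑ i, b i * ω i))) := fun _ _ => inferInstance
  apply Measure.ext_of_charFunDual
  ext L
  rw [key, key, haa, hbb, hab]

lemma map_eval_triple_gauss5 :
    gauss5.map (fun ω => (ω 0, ω 1, ω 2)) = stdGauss.prod (stdGauss.prod stdGauss) := by
  have hind : iIndepFun (fun (i : Fin 5) (ω : Fin 5 → ℝ) => ω i) gauss5 :=
    iIndepFun_pi (X := fun _ x => x) (fun _ => by fun_prop)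
  have hlaw : ∀ i : Fin 5, HasLaw (fun ω : Fin 5 → ℝ => ω i) stdGauss gauss5 := fun i =>
    (measurePreserving_eval (fun _ : Fin 5 => stdGauss) i).hasLaw
  have h12 := (hind.indepFun (i := 1) (j := 2) (by decide)).hasLaw_prod (hlaw 1) (hlaw 2)
  have h0 := (hind.indepFun_prodMk (fun i => by fun_prop) 1 2 0 (by decide) (by decide)).symm
  exact (h0.hasLaw_prod (hlaw 0) h12).map_eq

lemma psi_eq_integral_gauss5 {q α t : ℝ} {f : ℝ → ℝ} (hf : Continuous f) (ht : 0 ≤ t)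
    (htq : t ≤ q) {a b : Fin 5 → ℝ} (haa : ∑ i, a i ^ 2 = q) (hbb : ∑ i, b i ^ 2 = q)
    (hab : ∑ i, a i * b i = t) :
    psi q α f t = α * ∫ ω, f (∑ i, a i * ω i) * f (∑ i, b i * ω i) ∂gauss5 := by
  have h1 := Real.sq_sqrt ht
  have h2 := Real.sq_sqrt (sub_nonneg.2 htq)
  have hc : Continuous fun p : ℝ × ℝ => f p.1 * f p.2 := by fun_prop
  have hpair : ∀ a b : Fin 5 → ℝ, ∫ ω, f (∑ i, a i * ω i) * f (∑ i, b i * ω i) ∂gauss5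
      = ∫ p, f p.1 * f p.2 ∂gauss5.map (fun ω => (∑ i, a i * ω i, ∑ i, b i * ω i)) := by
    intro a b
    have hcont : Continuous fun ω : Fin 5 → ℝ => (∑ i, a i * ω i, ∑ i, b i * ω i) := by
      fun_prop
    rw [integral_map hcont.aemeasurable hc.aestronglyMeasurable]
  rw [hpair, map_linear_pair_gauss5_eq (a' := ![√t, √(q - t), 0, 0, 0])
    (b' := ![√t, 0, √(q - t), 0, 0]), ← hpair, psi, ← map_eval_triple_gauss5,
    integral_map (by fun_prop) (by fun_prop : Continuous _).aestronglyMeasurable]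
  · simp [Fin.sum_univ_five]
  · rw [haa]; simp [Fin.sum_univ_five, h1, h2]
  · rw [hbb]; simp [Fin.sum_univ_five, h1, h2]
  · rw [hab]; simp [Fin.sum_univ_five, ← sq, h1]

lemma integral_sq_sum_comp_linear {f : ℝ → ℝ} (hf : Differentiable ℝ f) {C : ℝ}
    (hC : ∀ x, |deriv f x| ≤ C) {n : ℕ} (e : Fin n → ℝ) (c : Fin n → Fin 5 → ℝ) :
    ∫ ω, (∑ k, e k * f (∑ i, c k i * ω i)) ^ 2 ∂gauss5
      = ∑ k, ∑ l, e k * e l * ∫ ω, f (∑ i, c k i * ω i) * f (∑ i, c l i * ω i) ∂gauss5 := by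
  have hint : ∀ k l, Integrable
      (fun ω => e k * e l * (f (∑ i, c k i * ω i) * f (∑ i, c l i * ω i))) gauss5 := fun k l =>
    ((memLp_comp_linear_gauss5 hf hC (c k)).integrable_mul
      (memLp_comp_linear_gauss5 hf hC (c l))).const_mul _
  have h1 : ∀ ω : Fin 5 → ℝ, (∑ k, e k * f (∑ i, c k i * ω i)) ^ 2
      = ∑ k, ∑ l, e k * e l * (f (∑ i, c k i * ω i) * f (∑ i, c l i * ω i)) := by
    intro ω
    rw [sq, Finset.sum_mul_sum]
    exact Finset.sum_congr rfl fun k _ => Finset.sum_congr rfl fun l _ => by ring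
  simp_rw [h1]
  rw [integral_finsetSum _ fun k _ => integrable_finsetSum _ fun l _ => hint k l]
  refine Finset.sum_congr rfl fun k _ => ?_
  rw [integral_finsetSum _ fun l _ => hint k l]
  exact Finset.sum_congr rfl fun l _ => integral_const_mul _ _

/-- The second difference of `psi` at `q`, as the expectation of a square. -/
lemma psi_second_difference {q α v : ℝ} {f : ℝ → ℝ} (hf : Differentiable ℝ f) {C : ℝ}
    (hC : ∀ x, |deriv f x| ≤ C) (hv : 0 ≤ v) (hvq : v ≤ q) :
    4 * (psi q α f q - 2 * psi q α f (q - v / 2) + psi q α f (q - v))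
      = α * ∫ ω : Fin 5 → ℝ,
          (f (√(q - v) * ω 0 + √(v / 2) * ω 1 + √(v / 2) * ω 3)
            - f (√(q - v) * ω 0 + √(v / 2) * ω 2 + √(v / 2) * ω 3)
            - f (√(q - v) * ω 0 + √(v / 2) * ω 1 + √(v / 2) * ω 4)
            + f (√(q - v) * ω 0 + √(v / 2) * ω 2 + √(v / 2) * ω 4)) ^ 2 ∂gauss5 := by
  have hr := Real.sq_sqrt (sub_nonneg.2 hvq)
  have hs := Real.sq_sqrt (by positivity : 0 ≤ v / 2)
  set r := √(q - v)
  set s := √(v / 2)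
  let c : Fin 4 → Fin 5 → ℝ := ![![r, s, 0, s, 0], ![r, 0, s, s, 0], ![r, s, 0, 0, s],
    ![r, 0, s, 0, s]]
  have h := integral_sq_sum_comp_linear hf hC ![1, -1, -1, 1] c
  have hcc : ∀ k, ∑ i, c k i ^ 2 = q := by
    intro k
    fin_cases k <;> simp [c, Fin.sum_univ_five] <;> linarith
  have hpsi : ∀ k l t, 0 ≤ t → t ≤ q → ∑ i, c k i * c l i = t →
      α * ∫ ω, f (∑ i, c k i * ω i) * f (∑ i, c l i * ω i) ∂gauss5 = psi q α f t :=
    fun k l t h0 h1 h2 => (psi_eq_integral_gauss5 hf.continuous h0 h1 (hcc k) (hcc l) h2).symm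
  have hq : ∀ k, α * ∫ ω, f (∑ i, c k i * ω i) * f (∑ i, c k i * ω i) ∂gauss5 = psi q α f q :=
    fun k => hpsi k k q (hv.trans hvq) le_rfl (by simpa [sq] using hcc k)
  have hmid : ∀ k l, ∑ i, c k i * c l i = r ^ 2 + s ^ 2 →
      α * ∫ ω, f (∑ i, c k i * ω i) * f (∑ i, c l i * ω i) ∂gauss5 = psi q α f (q - v / 2) :=
    fun k l h2 => hpsi k l _ (by linarith) (by linarith) (by rw [h2]; linarith)
  have hfar : ∀ k l, ∑ i, c k i * c l i = r ^ 2 →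
      α * ∫ ω, f (∑ i, c k i * ω i) * f (∑ i, c l i * ω i) ∂gauss5 = psi q α f (q - v) :=
    fun k l h2 => hpsi k l _ (by linarith) (by linarith) (by rw [h2]; linarith)
  have h' := congrArg (α * ·) h
  simp only [Finset.mul_sum, mul_left_comm α] at h'
  simp only [Fin.sum_univ_four, hq] at h'
  rw [hmid 0 1, hmid 0 2, hfar 0 3, hmid 1 0, hfar 1 2, hmid 1 3, hmid 2 0, hfar 2 1, hmid 2 3,
    hfar 3 0, hmid 3 1, hmid 3 2] at h'
  · simp [c, Fin.sum_univ_five] at h'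
    simp only [sub_eq_add_neg] at h' ⊢
    rw [h']
    ring
  all_goals simp [c, Fin.sum_univ_five]; try ring

lemma integral_sq_stdGauss : ∫ x, x ^ 2 ∂stdGauss = 1 := by
  have h := variance_fun_id_gaussianReal (μ := 0) (v := 1)
  rw [variance_eq_integral measurable_id'.aemeasurable] at h
  simpa [stdGauss] using h

lemma integral_sq_mul_sq_sub_gauss5 {g : ℝ → ℝ} (hg : Continuous g) :
    ∫ ω : Fin 5 → ℝ, g (ω 0) ^ 2 * (ω 1 - ω 2) ^ 2 ∂gauss5
      = 2 * ∫ z, g z ^ 2 ∂stdGauss := by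
  have h1 : ∫ ω : Fin 5 → ℝ, g (ω 0) ^ 2 * (ω 1 - ω 2) ^ 2 ∂gauss5
      = ∫ p : ℝ × ℝ × ℝ, g p.1 ^ 2 * (p.2.1 - p.2.2) ^ 2
        ∂stdGauss.prod (stdGauss.prod stdGauss) := by
    rw [← map_eval_triple_gauss5,
      integral_map (by fun_prop) (by fun_prop : Continuous _).aestronglyMeasurable]
  have h0 : ∫ x, x ∂stdGauss = 0 := integral_id_gaussianReal
  have hi := memLp_id_stdGauss.integrable one_le_two
  have hi2 := memLp_id_stdGauss.integrable_sq
  have h2 : ∫ p : ℝ × ℝ, (p.1 - p.2) ^ 2 ∂stdGauss.prod stdGauss = 2 := by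
    have e : ∀ p : ℝ × ℝ, (p.1 - p.2) ^ 2 = p.1 ^ 2 + p.2 ^ 2 - 2 * (p.1 * p.2) := fun p => by ring
    simp_rw [e]
    rw [integral_sub (f := fun p : ℝ × ℝ => p.1 ^ 2 + p.2 ^ 2) ((hi2.comp_fst _).add (hi2.comp_snd _)) ((hi.mul_prod hi).const_mul 2),
      integral_add (hi2.comp_fst _) (hi2.comp_snd _), integral_const_mul,
      integral_prod_mul (fun x : ℝ => x) (fun x : ℝ => x),
      integral_fun_fst (fun x : ℝ => x ^ 2), integral_fun_snd (fun x : ℝ => x ^ 2),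
      integral_sq_stdGauss, h0]
    norm_num
  rw [h1, integral_prod_mul (fun x => g x ^ 2) (fun p : ℝ × ℝ => (p.1 - p.2) ^ 2), h2, mul_comm]

lemma psi_self {q α : ℝ} {f : ℝ → ℝ} :
    psi q α f q = α * ∫ z, f (√q * z) ^ 2 ∂stdGauss := by
  have h := integral_fun_fst (μ := stdGauss) (ν := stdGauss.prod stdGauss)
    (fun z => f (√q * z) ^ 2)
  simp only [psi, sub_self, Real.sqrt_zero, zero_mul, add_zero, ← sq]
  rw [h]
  simp

/-- The increment of `psi` at `q`, as the expectation of a square. -/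
lemma psi_self_sub {q α t : ℝ} {f : ℝ → ℝ} (hf : Differentiable ℝ f) {C : ℝ}
    (hC : ∀ x, |deriv f x| ≤ C) (ht : 0 ≤ t) (htq : t ≤ q) :
    2 * (psi q α f q - psi q α f t)
      = α * ∫ ω : Fin 5 → ℝ, (f (√t * ω 0 + √(q - t) * ω 1)
          - f (√t * ω 0 + √(q - t) * ω 2)) ^ 2 ∂gauss5 := by
  have hr := Real.sq_sqrt ht
  have hs := Real.sq_sqrt (sub_nonneg.2 htq)
  set r := √t
  set s := √(q - t)
  let c : Fin 2 → Fin 5 → ℝ := ![![r, s, 0, 0, 0], ![r, 0, s, 0, 0]]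
  have h := integral_sq_sum_comp_linear hf hC ![1, -1] c
  have hcc : ∀ k, ∑ i, c k i ^ 2 = q := by
    intro k
    fin_cases k <;> simp [c, Fin.sum_univ_five] <;> linarith
  have hq : ∀ k, α * ∫ ω, f (∑ i, c k i * ω i) * f (∑ i, c k i * ω i) ∂gauss5 = psi q α f q :=
    fun k => (psi_eq_integral_gauss5 hf.continuous (ht.trans htq) le_rfl (hcc k) (hcc k)
      (by simpa [sq] using hcc k)).symm
  have hp : ∀ k l, ∑ i, c k i * c l i = r ^ 2 →
      α * ∫ ω, f (∑ i, c k i * ω i) * f (∑ i, c l i * ω i) ∂gauss5 = psi q α f t :=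
    fun k l h => (psi_eq_integral_gauss5 hf.continuous ht htq (hcc k) (hcc l)
      (h.trans hr)).symm
  have h' := congrArg (α * ·) h
  simp only [Finset.mul_sum, mul_left_comm α] at h'
  simp only [Fin.sum_univ_two, hq] at h'
  rw [hp 0 1, hp 1 0] at h'
  · simp [c, Fin.sum_univ_five] at h'
    simp only [sub_eq_add_neg] at h' ⊢
    rw [h']
    ring
  all_goals simp [c, Fin.sum_univ_five]; try ring

lemma hasDerivWithinAt_psi_self {q α : ℝ} (hq : 0 < q) {f : ℝ → ℝ} (hf : ContDiff ℝ 1 f) {C : ℝ}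
    (hC : ∀ x, |deriv f x| ≤ C) :
    HasDerivWithinAt (psi q α f) (α * ∫ z, deriv f (√q * z) ^ 2 ∂stdGauss) (Set.Iic q) q := by
  have hd : Differentiable ℝ f := hf.differentiable one_ne_zero
  have hcf := hf.continuous
  have hcd : Continuous (deriv f) := hf.continuous_deriv le_rfl
  rw [hasDerivWithinAt_iff_tendsto_slope, Set.Iic_sdiff_right]
  have hev : ∀ᶠ t in 𝓝[<] q, 0 < t ∧ t < q := by
    filter_upwards [self_mem_nhdsWithin, mem_nhdsWithin_of_mem_nhds (Ioi_mem_nhds hq)]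
      with t h1 h2 using ⟨h2, h1⟩
  let F : ℝ → (Fin 5 → ℝ) → ℝ := fun t ω =>
    ((f (√t * ω 0 + √(q - t) * ω 1) - f (√t * ω 0 + √(q - t) * ω 2)) / √(q - t)) ^ 2
  have hslope : ∀ᶠ t in 𝓝[<] q, α / 2 * ∫ ω, F t ω ∂gauss5 = slope (psi q α f) q t := by
    filter_upwards [hev] with t ⟨h0, h1⟩
    have h := psi_self_sub (α := α) hd hC h0.le h1.le
    have hqt : q - t ≠ 0 := (sub_pos.2 h1).ne'
    have htq : t - q ≠ 0 := (sub_neg.2 h1).ne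
    simp only [F, div_pow, Real.sq_sqrt (sub_nonneg.2 h1.le)]
    rw [integral_div, slope_def_field, ← mul_div_assoc, div_mul_eq_mul_div, ← h]
    field_simp
    ring
  refine Tendsto.congr' hslope ?_
  have hlim : α * ∫ z, deriv f (√q * z) ^ 2 ∂stdGauss
      = α / 2 * ∫ ω : Fin 5 → ℝ, deriv f (√q * ω 0) ^ 2 * (ω 1 - ω 2) ^ 2 ∂gauss5 := by
    rw [integral_sq_mul_sq_sub_gauss5 (g := fun z => deriv f (√q * z)) (by fun_prop)]
    ring
  rw [hlim]
  refine Tendsto.const_mul _ (tendsto_integral_filter_of_dominated_convergence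
    (fun ω => C ^ 2 * (ω 1 - ω 2) ^ 2) ?_ ?_ ?_ ?_)
  · exact Eventually.of_forall fun t => by
      refine Measurable.aestronglyMeasurable ?_
      have := hcf.measurable
      fun_prop
  · filter_upwards [hev] with t ⟨h0, h1⟩
    refine ae_of_all _ fun ω => ?_
    have hs : 0 < √(q - t) := Real.sqrt_pos.2 (sub_pos.2 h1)
    have h := abs_sub_le_of_deriv_bound hd hC (√t * ω 0 + √(q - t) * ω 1)
      (√t * ω 0 + √(q - t) * ω 2)
    rw [show √t * ω 0 + √(q - t) * ω 1 - (√t * ω 0 + √(q - t) * ω 2)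
      = √(q - t) * (ω 1 - ω 2) by ring, abs_mul, abs_of_pos hs] at h
    rw [Real.norm_of_nonneg (sq_nonneg _), ← mul_pow, ← sq_abs, ← sq_abs (C * _)]
    refine pow_le_pow_left₀ (abs_nonneg _) ?_ 2
    rw [abs_div, abs_of_pos hs, div_le_iff₀ hs, abs_mul]
    calc _ ≤ C * (√(q - t) * |ω 1 - ω 2|) := h
      _ ≤ |C| * (√(q - t) * |ω 1 - ω 2|) := by gcongr; exact le_abs_self C
      _ = _ := by ring
  · exact (((memLp_eval_gauss5 1).sub (memLp_eval_gauss5 2)).integrable_sq).const_mul _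
  · refine ae_of_all _ fun ω => ?_
    have hstrict : HasStrictDerivAt f (deriv f (√q * ω 0)) (√q * ω 0) :=
      hf.contDiffAt.hasStrictDerivAt one_ne_zero
    have hpt : ∀ y : ℝ, Tendsto (fun t => √t * ω 0 + √(q - t) * y) (𝓝[<] q) (𝓝 (√q * ω 0)) := by
      intro y
      have : Continuous fun t => √t * ω 0 + √(q - t) * y := by fun_prop
      simpa using (this.tendsto q).mono_left nhdsWithin_le_nhds
    have ho := hstrict.isLittleO.comp_tendsto
      ((hpt (ω 1)).prodMk_nhds (hpt (ω 2)))
    have hO : (fun t => √t * ω 0 + √(q - t) * ω 1 - (√t * ω 0 + √(q - t) * ω 2))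
        =O[𝓝[<] q] fun t => √(q - t) := by
      refine Asymptotics.IsBigO.of_bound |ω 1 - ω 2| (Eventually.of_forall fun t => le_of_eq ?_)
      rw [← Real.norm_eq_abs, ← norm_mul]
      congr 1
      ring
    have h := (ho.trans_isBigO hO).tendsto_div_nhds_zero
    rw [← mul_pow]
    refine Tendsto.pow ?_ 2
    have h2 := h.add_const (deriv f (√q * ω 0) * (ω 1 - ω 2))
    rw [zero_add] at h2
    refine h2.congr' ?_
    filter_upwards [hev] with t ⟨h0, h1⟩
    have hs : √(q - t) ≠ 0 := (Real.sqrt_pos.2 (sub_pos.2 h1)).ne'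
    simp only [Function.comp, ContinuousLinearMap.toSpanSingleton_apply, smul_eq_mul]
    field_simp
    ring

lemma deriv_deriv_eq_zero_of_sub_additive {f : ℝ → ℝ}
    (h : ∀ x y, f (x + y) = f x + f y - f 0) (z : ℝ) : deriv (deriv f) z = 0 := by
  have h1 : deriv f = fun _ => deriv f 0 := by
    ext x
    have e : (fun y => f (x + y)) = fun y => f x + f y - f 0 := funext (h x)
    have h2 := congrArg (fun g => deriv g 0) e
    simpa [deriv_comp_const_add] using h2
  rw [h1]
  simp

lemma psi_second_difference_pos {q α v : ℝ} (hα : 0 < α) {f : ℝ → ℝ} (hf : Differentiable ℝ f)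
    {C : ℝ} (hC : ∀ x, |deriv f x| ≤ C) (hf'' : ∃ y, deriv (deriv f) y ≠ 0) (hv : 0 < v)
    (hvq : v ≤ q) :
    0 < psi q α f q - 2 * psi q α f (q - v / 2) + psi q α f (q - v) := by
  have h := psi_second_difference (α := α) hf hC hv.le hvq
  have hc := hf.continuous
  set r := √(q - v)
  have hs : 0 < √(v / 2) := Real.sqrt_pos.2 (by positivity)
  set s := √(v / 2)
  let Δ : (Fin 5 → ℝ) → ℝ := fun ω => f (r * ω 0 + s * ω 1 + s * ω 3)
    - f (r * ω 0 + s * ω 2 + s * ω 3) - f (r * ω 0 + s * ω 1 + s * ω 4)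
    + f (r * ω 0 + s * ω 2 + s * ω 4)
  have hΔc : Continuous Δ := by fun_prop
  change _ = α * ∫ ω, Δ ω ^ 2 ∂gauss5 at h
  have hlin : ∀ i j, MemLp (fun ω : Fin 5 → ℝ => f (r * ω 0 + s * ω i + s * ω j)) 2 gauss5 := by
    intro i j
    refine (memLp_comp_linear_gauss5 hf hC
      (fun k => r * (Pi.single 0 1 : Fin 5 → ℝ) k + s * (Pi.single i 1 : Fin 5 → ℝ) k
        + s * (Pi.single j 1 : Fin 5 → ℝ) k)).congr_norm
      (by fun_prop : Continuous _).aestronglyMeasurable (ae_of_all _ fun ω => ?_)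
    simp [add_mul, Finset.sum_add_distrib, Pi.single_apply]
  have hint : Integrable (fun ω => Δ ω ^ 2) gauss5 :=
    ((((hlin 1 3).sub (hlin 2 3)).sub (hlin 1 4)).add (hlin 2 4)).integrable_sq
  have hpos : 0 < ∫ ω, Δ ω ^ 2 ∂gauss5 := by
    refine (integral_nonneg fun ω => sq_nonneg _).lt_of_ne' fun h0 => ?_
    rw [integral_eq_zero_iff_of_nonneg (fun ω => sq_nonneg _) hint] at h0
    have hz := Measure.eq_of_ae_eq h0 (hΔc.pow 2) continuous_const
    obtain ⟨y, hy⟩ := hf''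
    refine hy (deriv_deriv_eq_zero_of_sub_additive (fun a b => ?_) y)
    have := congrFun hz ![0, a / s, 0, b / s, 0]
    simp [Δ, mul_div_cancel₀ _ hs.ne'] at this
    linarith
  nlinarith [mul_pos hα hpos]

/-- A function whose second differences at `0` are nonnegative and which has derivative `c` there
stays below its tangent. -/
lemma le_mul_of_le_two_mul_half {D : ℝ → ℝ} {c q : ℝ} (hD0 : D 0 = 0)
    (hD : ∀ v, 0 < v → v ≤ q → D v ≤ 2 * D (v / 2))
    (hc : HasDerivWithinAt D c (Set.Ici 0) 0) {v : ℝ} (hv : 0 < v) (hvq : v ≤ q) :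
    D v ≤ c * v := by
  have hiter : ∀ n : ℕ, D v ≤ 2 ^ n * D (v / 2 ^ n) := by
    intro n
    induction n with
    | zero => simp
    | succ n ih =>
      have h1 : v / 2 ^ n ≤ v := div_le_self hv.le (one_le_pow₀ one_le_two)
      have h2 := hD (v / 2 ^ n) (by positivity) (h1.trans hvq)
      rw [div_div, ← pow_succ] at h2
      calc D v ≤ 2 ^ n * D (v / 2 ^ n) := ih
        _ ≤ 2 ^ n * (2 * D (v / 2 ^ (n + 1))) := by gcongr
        _ = _ := by ring
  have hlim : Tendsto (fun n : ℕ => v / 2 ^ n) atTop (𝓝[>] 0) := by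
    refine tendsto_nhdsWithin_iff.2 ⟨?_, Eventually.of_forall fun n => ?_⟩
    · exact tendsto_const_nhds.div_atTop (tendsto_pow_atTop_atTop_of_one_lt one_lt_two)
    · exact Set.mem_Ioi.2 (by positivity)
  rw [hasDerivWithinAt_iff_tendsto_slope, Set.Ici_sdiff_left] at hc
  have h := (hc.comp hlim).mul_const v
  refine ge_of_tendsto' h fun n => (hiter n).trans (le_of_eq ?_)
  simp only [Function.comp, slope_def_field, hD0, sub_zero]
  field_simp

/-- part of Lemma 3.3: under the fixed-point conditions
`α·E[f(√q̲·Z)²] = q̲` and `α·E[f′(√q̲·Z)²] = 1`, one has `ψ(q̲) = q̲`, the left derivative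
of `ψ` at `q̲` equals `1`, and `ψ(t) ≥ t` on `[0, q̲]`; if moreover `f″` is not identically
zero then `ψ(t) > t` for every `t ∈ [0, q̲)`. -/
theorem statement_7 (qlow α : ℝ) (hq : qlow ∈ Set.Ioc (0 : ℝ) 1) (hα : 0 < α)
    (f : ℝ → ℝ) (hf : ContDiff ℝ 2 f)
    (hf' : ∃ C, ∀ x, |deriv f x| ≤ C)
    (hf'' : ∃ C, ∀ x, |deriv (deriv f) x| ≤ C)
    (hfix : α * ∫ z, (f (Real.sqrt qlow * z)) ^ 2 ∂stdGauss = qlow)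
    (hfix' : α * ∫ z, (deriv f (Real.sqrt qlow * z)) ^ 2 ∂stdGauss = 1) :
    psi qlow α f qlow = qlow ∧
    HasDerivWithinAt (psi qlow α f) 1 (Set.Iic qlow) qlow ∧
    (∀ t ∈ Set.Icc (0 : ℝ) qlow, t ≤ psi qlow α f t) ∧
    ((∃ y, deriv (deriv f) y ≠ 0) → ∀ t ∈ Set.Ico (0 : ℝ) qlow, t < psi qlow α f t) := by
  obtain ⟨C, hC⟩ := hf'
  have hd : Differentiable ℝ f := hf.differentiable two_ne_zero
  have hself : psi qlow α f qlow = qlow := psi_self.trans hfix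
  have hderiv : HasDerivWithinAt (psi qlow α f) 1 (Set.Iic qlow) qlow :=
    hfix' ▸ hasDerivWithinAt_psi_self hq.1 (hf.of_le one_le_two) hC
  let D : ℝ → ℝ := fun v => qlow - psi qlow α f (qlow - v)
  have hD0 : D 0 = 0 := by simp [D, hself]
  have hD : ∀ v, 0 < v → v ≤ qlow → D v ≤ 2 * D (v / 2) := by
    intro v h0 h1
    have h := psi_second_difference (α := α) hd hC h0.le h1
    have : 0 ≤ 4 * (psi qlow α f qlow - 2 * psi qlow α f (qlow - v / 2)
        + psi qlow α f (qlow - v)) :=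
      h ▸ mul_nonneg hα.le (integral_nonneg fun ω => sq_nonneg _)
    simp only [D]
    linarith
  have hDderiv : HasDerivWithinAt D 1 (Set.Ici 0) 0 := by
    have h1 : HasDerivWithinAt (fun v : ℝ => qlow - v) (-1) (Set.Ici 0) 0 :=
      ((hasDerivAt_id' (0 : ℝ)).const_sub qlow).hasDerivWithinAt
    have h2 := HasDerivWithinAt.comp_of_eq (0 : ℝ) hderiv h1
      (fun v hv => by simpa using hv) (by simp)
    simpa [D] using! h2.const_sub qlow
  have hle : ∀ v, 0 < v → v ≤ qlow → D v ≤ v := fun v h0 h1 => by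
    simpa using le_mul_of_le_two_mul_half hD0 hD hDderiv h0 h1
  refine ⟨hself, hderiv, fun t ht => ?_, fun hne t ht => ?_⟩
  · rcases ht.2.eq_or_lt with rfl | h
    · exact hself.ge
    · have := hle (qlow - t) (by linarith) (by linarith [ht.1])
      simp only [D, sub_sub_cancel] at this
      linarith
  · have hv : 0 < qlow - t := sub_pos.2 ht.2
    have h1 := psi_second_difference_pos hα hd hC hne hv (sub_le_self _ ht.1)
    have h2 := hle ((qlow - t) / 2) (by linarith) (by linarith [ht.1])
    simp only [D, sub_sub_cancel] at h1 h2
    linarith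
end

section
/- Let q̲ ∈ (0,1], α > 0, and let f : ℝ → ℝ be measurable with E[f(√q̲·Z)²] < ∞ and α·E[f(√q̲·Z)²] = q̲, where Z is standard Gaussian. Define ψ(t) = α·E[f(√t·Z + √(q̲−t)·Z′)·f(√t·Z + √(q̲−t)·Z″)] for t ∈ [0, q̲] (Z, Z′, Z″ i.i.d. standard Gaussian); then ψ maps [0, q̲] into [0, q̲], so the sequence a_0 = 0, a_{k+1} = ψ(a_k) is well-defined. Let (V^j)_{j≥0} be a centered jointly Gaussian sequence satisfying E[(V^0)²] = q̲, E[V^ℓ·V^0] = 0 for all ℓ ≥ 1, and E[V^ℓ·V^j] = α·E[f(V^{ℓ−1})·f(V^{j−1})] for all ℓ, j ≥ 1. Then E[(V^ℓ)²] = q̲ for every ℓ ≥ 0, and E[V^ℓ·V^k] = a_k for all 0 ≤ k < ℓ. (Lemma 3.2.) -/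
open MeasureTheory ProbabilityTheory

instance isProbabilityMeasure_stdGauss : IsProbabilityMeasure stdGauss := by
  unfold stdGauss; infer_instance

lemma map_mul_stdGauss (c : ℝ) :
    stdGauss.map (fun z => c * z) = gaussianReal 0 (c ^ 2).toNNReal := by
  rw [stdGauss, gaussianReal_map_const_mul, mul_zero, mul_one]
  congr 1
  ext
  simp [sq_nonneg]

/-- Adding an independent scaled standard Gaussian to a centered Gaussian. -/
lemma map_mul_add_stdGauss_prod {β : Type*} [MeasurableSpace β] {ν : Measure β}
    [IsProbabilityMeasure ν] {g : β → ℝ} (hg : Measurable g) {w : ℝ} (hw : 0 ≤ w)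
    (hν : ν.map g = gaussianReal 0 w.toNNReal) (c : ℝ) :
    (stdGauss.prod ν).map (fun p => c * p.1 + g p.2) =
      gaussianReal 0 (c ^ 2 + w).toNNReal := by
  have hind := indepFun_prod (μ := stdGauss) (ν := ν) (X := fun z => c * z) (Y := g)
    (by fun_prop) hg
  have hfst : (stdGauss.prod ν).map (fun p : ℝ × β => c * p.1) =
      gaussianReal 0 (c ^ 2).toNNReal := by
    have h := Measure.map_map (μ := stdGauss.prod ν) (g := fun z => c * z)
      (by fun_prop) measurable_fst
    rw [measurePreserving_fst.map_eq, map_mul_stdGauss] at h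
    exact h.symm
  have hsnd : (stdGauss.prod ν).map (fun p : ℝ × β => g p.2) =
      gaussianReal 0 w.toNNReal := by
    have h := Measure.map_map (μ := stdGauss.prod ν) hg measurable_snd
    rw [measurePreserving_snd.map_eq, hν] at h
    exact h.symm
  have h := gaussianReal_add_gaussianReal_of_indepFun hind hfst hsnd
  rw [add_zero, ← Real.toNNReal_add (sq_nonneg c) hw] at h
  exact h

lemma map_linearCombination_stdGauss (a b c : ℝ) :
    (stdGauss.prod (stdGauss.prod stdGauss)).map
      (fun w : ℝ × ℝ × ℝ => a * w.1 + (b * w.2.1 + c * w.2.2)) =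
      gaussianReal 0 (a ^ 2 + (b ^ 2 + c ^ 2)).toNNReal :=
  map_mul_add_stdGauss_prod (g := fun p : ℝ × ℝ => b * p.1 + c * p.2) (by fun_prop)
    (by positivity)
    (map_mul_add_stdGauss_prod (by fun_prop) (sq_nonneg c) (map_mul_stdGauss c) b) a

section GaussianLaw

variable {Ω : Type*} [MeasurableSpace Ω] {P : Measure Ω} {X Y : Ω → ℝ}

lemma memLp_two_of_map_eq_gaussianReal (hX : Measurable X) {v : NNReal}
    (h : P.map X = gaussianReal 0 v) : MemLp X 2 P := by
  have h2 := memLp_id_gaussianReal (μ := 0) (v := v) 2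
  rw [← h, memLp_map_measure_iff (by fun_prop) hX.aemeasurable] at h2
  exact h2

lemma integral_sq_of_map_eq_gaussianReal (hX : Measurable X) {v : NNReal}
    (h : P.map X = gaussianReal 0 v) : ∫ ω, X ω ^ 2 ∂P = v := by
  have h2 := variance_fun_id_gaussianReal (μ := 0) (v := v)
  rw [variance_eq_integral measurable_id'.aemeasurable] at h2
  simp only [integral_id_gaussianReal, sub_zero] at h2
  rw [← h, integral_map hX.aemeasurable (by fun_prop)] at h2
  exact h2

lemma map_eq_gaussianReal_integral_sq (hX : Measurable X)
    (h : ∃ v : NNReal, P.map X = gaussianReal 0 v) :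
    P.map X = gaussianReal 0 (∫ ω, X ω ^ 2 ∂P).toNNReal := by
  obtain ⟨v, hv⟩ := h
  rw [integral_sq_of_map_eq_gaussianReal hX hv, Real.toNNReal_coe, hv]

variable {q : ℝ} {f : ℝ → ℝ}

lemma map_eq_map_sqrt_mul_stdGauss (hq : 0 ≤ q) (h : P.map X = gaussianReal 0 q.toNNReal) :
    P.map X = stdGauss.map (fun z => √q * z) := by
  rw [h, map_mul_stdGauss, Real.sq_sqrt hq]

lemma memLp_two_comp_of_map_eq_gaussianReal (hq : 0 ≤ q) (hfm : Measurable f)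
    (hint : Integrable (fun z => f (√q * z) ^ 2) stdGauss) (hX : Measurable X)
    (h : P.map X = gaussianReal 0 q.toNNReal) : MemLp (fun ω => f (X ω)) 2 P := by
  have h1 : MemLp (f ∘ (fun z => √q * z)) 2 stdGauss :=
    (memLp_two_iff_integrable_sq (hfm.comp (by fun_prop)).aestronglyMeasurable).2 hint
  rw [← memLp_map_measure_iff (by fun_prop) (by fun_prop),
    ← map_eq_map_sqrt_mul_stdGauss hq h,
    memLp_map_measure_iff (by fun_prop) (by fun_prop)] at h1
  exact h1

lemma integral_comp_sq_of_map_eq_gaussianReal (hq : 0 ≤ q) (hfm : Measurable f)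
    (hX : Measurable X) (h : P.map X = gaussianReal 0 q.toNNReal) :
    ∫ ω, f (X ω) ^ 2 ∂P = ∫ z, f (√q * z) ^ 2 ∂stdGauss := by
  rw [← integral_map (φ := X) (f := fun x => f x ^ 2) (by fun_prop) (by fun_prop),
    map_eq_map_sqrt_mul_stdGauss hq h, integral_map (by fun_prop) (by fun_prop)]

/-- The cross moment of two `L²` functions is at most their common second moment. -/
lemma integral_mul_le_of_integral_sq_eq {m : ℝ} (hX : MemLp X 2 P) (hY : MemLp Y 2 P)
    (hXm : ∫ ω, X ω ^ 2 ∂P = m) (hYm : ∫ ω, Y ω ^ 2 ∂P = m) :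
    ∫ ω, X ω * Y ω ∂P ≤ m := by
  have h : ∫ ω, X ω * Y ω ∂P ≤ ∫ ω, (X ω ^ 2 + Y ω ^ 2) / 2 ∂P :=
    integral_mono (hX.integrable_mul hY)
      ((hX.integrable_sq.add hY.integrable_sq).div_const 2)
      (fun ω => by nlinarith [sq_nonneg (X ω - Y ω)])
  rw [integral_div, integral_add hX.integrable_sq hY.integrable_sq, hXm, hYm] at h
  linarith

lemma integral_linearCombination_sq (hX : MemLp X 2 P) (hY : MemLp Y 2 P) (c d : ℝ) :
    ∫ ω, (c * X ω + d * Y ω) ^ 2 ∂P =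
      c ^ 2 * ∫ ω, X ω ^ 2 ∂P + 2 * c * d * ∫ ω, X ω * Y ω ∂P +
        d ^ 2 * ∫ ω, Y ω ^ 2 ∂P := by
  have hXY : Integrable (fun ω => X ω * Y ω) P := hX.integrable_mul hY
  have hsum : Integrable (fun ω => c ^ 2 * X ω ^ 2 + 2 * c * d * (X ω * Y ω)) P :=
    (hX.integrable_sq.const_mul _).add (hXY.const_mul _)
  rw [← integral_const_mul, ← integral_const_mul, ← integral_const_mul,
    ← integral_add (hX.integrable_sq.const_mul _) (hXY.const_mul _),
    ← integral_add hsum (hY.integrable_sq.const_mul _)]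
  congr with ω
  ring

end GaussianLaw

/-- Finite measures on the plane with the same one-dimensional projections are equal. -/
lemma ext_of_map_linearCombination {μ ν : Measure (ℝ × ℝ)} [IsFiniteMeasure μ]
    [IsFiniteMeasure ν]
    (h : ∀ c d : ℝ, μ.map (fun p => c * p.1 + d * p.2) = ν.map (fun p => c * p.1 + d * p.2)) :
    μ = ν := by
  refine Measure.ext_of_charFunDual (funext fun L => ?_)
  have hL : (L : ℝ × ℝ → ℝ) = fun p => L (1, 0) * p.1 + L (0, 1) * p.2 := by
    ext p
    have hp : p = p.1 • ((1 : ℝ), (0 : ℝ)) + p.2 • ((0 : ℝ), (1 : ℝ)) := by ext <;> simp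
    conv_lhs => rw [hp, map_add, map_smul, map_smul]
    simp [mul_comm]
  rw [charFunDual_eq_charFun_map_one, charFunDual_eq_charFun_map_one, hL, h]

/-- The correlated pair used in `psi` has covariance `(q, t; t, q)`. -/
lemma map_linearCombination_correlated {q t : ℝ} (ht : t ∈ Set.Icc 0 q) (c d : ℝ) :
    (stdGauss.prod (stdGauss.prod stdGauss)).map
      (fun w : ℝ × ℝ × ℝ => c * (√t * w.1 + √(q - t) * w.2.1) +
        d * (√t * w.1 + √(q - t) * w.2.2)) =
      gaussianReal 0 (c ^ 2 * q + 2 * c * d * t + d ^ 2 * q).toNNReal := by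
  have h := map_linearCombination_stdGauss ((c + d) * √t) (c * √(q - t)) (d * √(q - t))
  simp only [mul_pow, Real.sq_sqrt ht.1, Real.sq_sqrt (sub_nonneg.2 ht.2)] at h
  convert! h using 2
  · ext w
    ring
  · congr 1
    ring

lemma psi_mem_Icc {q α : ℝ} (hq : 0 ≤ q) (hα : 0 < α) {f : ℝ → ℝ} (hfm : Measurable f)
    (hint : Integrable (fun z => f (√q * z) ^ 2) stdGauss)
    (hfix : α * ∫ z, f (√q * z) ^ 2 ∂stdGauss = q) {t : ℝ} (ht : t ∈ Set.Icc 0 q) :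
    psi q α f t ∈ Set.Icc 0 q := by
  have hl1 : (stdGauss.prod (stdGauss.prod stdGauss)).map
      (fun w : ℝ × ℝ × ℝ => √t * w.1 + √(q - t) * w.2.1) = gaussianReal 0 q.toNNReal := by
    simpa using map_linearCombination_correlated ht 1 0
  have hl2 : (stdGauss.prod (stdGauss.prod stdGauss)).map
      (fun w : ℝ × ℝ × ℝ => √t * w.1 + √(q - t) * w.2.2) = gaussianReal 0 q.toNNReal := by
    simpa using map_linearCombination_correlated ht 0 1
  have hm1 := memLp_two_comp_of_map_eq_gaussianReal hq hfm hint (by fun_prop) hl1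
  have hm2 := memLp_two_comp_of_map_eq_gaussianReal hq hfm hint (by fun_prop) hl2
  constructor
  · refine mul_nonneg hα.le ?_
    refine le_of_le_of_eq (integral_nonneg fun z => ?_)
      (integral_prod _ (hm1.integrable_mul hm2)).symm
    have h := integral_prod_mul (μ := stdGauss) (ν := stdGauss)
      (fun x => f (√t * z + √(q - t) * x)) (fun x => f (√t * z + √(q - t) * x))
    exact (mul_self_nonneg _).trans_eq h.symm
  · rw [psi]
    conv_rhs => rw [← hfix]
    exact mul_le_mul_of_nonneg_left (integral_mul_le_of_integral_sq_eq hm1 hm2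
      (integral_comp_sq_of_map_eq_gaussianReal hq hfm (by fun_prop) hl1)
      (integral_comp_sq_of_map_eq_gaussianReal hq hfm (by fun_prop) hl2)) hα.le

/-- For a centered Gaussian pair `(X, Y)` with covariance `(q, t; t, q)`, the value `psi t` is
`α * E[f(X) f(Y)]`. -/
lemma psi_eq_integral_mul {Ω : Type*} [MeasurableSpace Ω] {P : Measure Ω}
    [IsProbabilityMeasure P] {X Y : Ω → ℝ} (hX : Measurable X) (hY : Measurable Y)
    (hXY : ∀ c d : ℝ, ∃ v : NNReal, P.map (fun ω => c * X ω + d * Y ω) = gaussianReal 0 v)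
    {q t : ℝ} (ht : t ∈ Set.Icc 0 q) (hXq : ∫ ω, X ω ^ 2 ∂P = q)
    (hYq : ∫ ω, Y ω ^ 2 ∂P = q) (hcov : ∫ ω, X ω * Y ω ∂P = t)
    (α : ℝ) {f : ℝ → ℝ} (hfm : Measurable f) :
    α * ∫ ω, f (X ω) * f (Y ω) ∂P = psi q α f t := by
  have hX2 : MemLp X 2 P := by
    obtain ⟨v, hv⟩ := hXY 1 0
    exact memLp_two_of_map_eq_gaussianReal hX (v := v) (by simpa using hv)
  have hY2 : MemLp Y 2 P := by
    obtain ⟨v, hv⟩ := hXY 0 1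
    exact memLp_two_of_map_eq_gaussianReal hY (v := v) (by simpa using hv)
  have hlaw : P.map (fun ω => (X ω, Y ω)) =
      (stdGauss.prod (stdGauss.prod stdGauss)).map (fun w : ℝ × ℝ × ℝ =>
        (√t * w.1 + √(q - t) * w.2.1, √t * w.1 + √(q - t) * w.2.2)) := by
    have := Measure.isProbabilityMeasure_map (μ := P) (hX.prodMk hY).aemeasurable
    refine ext_of_map_linearCombination fun c d => ?_
    rw [Measure.map_map (by fun_prop) (by fun_prop), Measure.map_map (by fun_prop) (by fun_prop)]
    refine Eq.trans ?_ (map_linearCombination_correlated ht c d).symm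
    have h := map_eq_gaussianReal_integral_sq (by fun_prop) (hXY c d)
    rw [integral_linearCombination_sq hX2 hY2, hXq, hYq, hcov] at h
    exact h
  rw [psi, ← integral_map (φ := fun ω => (X ω, Y ω)) (f := fun p : ℝ × ℝ => f p.1 * f p.2)
    (by fun_prop) (by fun_prop), hlaw, integral_map (by fun_prop) (by fun_prop)]

/-- Lemma 3.2: under the fixed-point condition `α·E[f(√q̲·Z)²] = q̲`, the
map `ψ` sends `[0,q̲]` into itself (so `a_0 = 0`, `a_{k+1} = ψ(a_k)` is well defined), and
any centered jointly Gaussian sequence `(V^j)` with `E[(V^0)²] = q̲`, `E[V^ℓ V^0] = 0` for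
`ℓ ≥ 1`, and `E[V^ℓ V^j] = α·E[f(V^{ℓ−1}) f(V^{j−1})]` for `ℓ, j ≥ 1` satisfies
`E[(V^ℓ)²] = q̲` for all `ℓ` and `E[V^ℓ V^k] = a_k` for all `0 ≤ k < ℓ`. -/
theorem statement_9 (qlow α : ℝ) (hq : qlow ∈ Set.Ioc (0 : ℝ) 1) (hα : 0 < α)
    (f : ℝ → ℝ) (hfm : Measurable f)
    (hint : Integrable (fun z => (f (Real.sqrt qlow * z)) ^ 2) stdGauss)
    (hfix : α * ∫ z, (f (Real.sqrt qlow * z)) ^ 2 ∂stdGauss = qlow)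
    (Ω : Type*) [MeasureSpace Ω] [IsProbabilityMeasure (ℙ : Measure Ω)]
    (V : ℕ → Ω → ℝ) (hVmeas : ∀ j, Measurable (V j))
    -- `(V^j)` is a centered jointly Gaussian sequence: every finite linear combination
    -- of the `V^j` is a centered Gaussian random variable.
    (hGauss : ∀ (s : Finset ℕ) (c : ℕ → ℝ), ∃ v : NNReal,
      Measure.map (fun ω => ∑ j ∈ s, c j * V j ω) ℙ = gaussianReal 0 v)
    (hV0 : ∫ ω, (V 0 ω) ^ 2 = qlow)
    (hV0' : ∀ ℓ : ℕ, ∫ ω, V (ℓ + 1) ω * V 0 ω = 0)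
    (hrec : ∀ ℓ j : ℕ, ∫ ω, V (ℓ + 1) ω * V (j + 1) ω = α * ∫ ω, f (V ℓ ω) * f (V j ω))
    (a : ℕ → ℝ) (ha0 : a 0 = 0) (harec : ∀ k, a (k + 1) = psi qlow α f (a k)) :
    (∀ t ∈ Set.Icc (0 : ℝ) qlow, psi qlow α f t ∈ Set.Icc (0 : ℝ) qlow) ∧
    (∀ ℓ : ℕ, ∫ ω, (V ℓ ω) ^ 2 = qlow) ∧
    (∀ k ℓ : ℕ, k < ℓ → ∫ ω, V ℓ ω * V k ω = a k) := by
  have hq0 := hq.1.le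
  have hψ : ∀ t ∈ Set.Icc (0 : ℝ) qlow, psi qlow α f t ∈ Set.Icc (0 : ℝ) qlow :=
    fun t ht => psi_mem_Icc hq0 hα hfm hint hfix ht
  have hG1 : ∀ ℓ, ∃ v : NNReal, Measure.map (V ℓ) ℙ = gaussianReal 0 v := by
    intro ℓ
    obtain ⟨v, hv⟩ := hGauss {ℓ} (fun _ => 1)
    exact ⟨v, by simpa using hv⟩
  have hvar : ∀ ℓ : ℕ, ∫ ω, (V ℓ ω) ^ 2 = qlow := by
    intro ℓ
    induction ℓ with
    | zero => exact hV0
    | succ ℓ ih =>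
      have hlaw := map_eq_gaussianReal_integral_sq (hVmeas ℓ) (hG1 ℓ)
      rw [ih] at hlaw
      have h := hrec ℓ ℓ
      simp only [← sq] at h
      rw [h, integral_comp_sq_of_map_eq_gaussianReal hq0 hfm (hVmeas ℓ) hlaw, hfix]
  have ha : ∀ k, a k ∈ Set.Icc (0 : ℝ) qlow := by
    intro k
    induction k with
    | zero => exact ha0.symm ▸ ⟨le_rfl, hq0⟩
    | succ k ih => exact harec k ▸ hψ _ ih
  refine ⟨hψ, hvar, fun k => ?_⟩
  induction k with
  | zero =>
    intro ℓ hℓ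
    obtain ⟨m, rfl⟩ := Nat.exists_eq_add_one.2 hℓ
    rw [hV0', ha0]
  | succ k ih =>
    intro ℓ hℓ
    obtain ⟨m, rfl⟩ := Nat.exists_eq_add_one.2 (Nat.zero_lt_of_lt hℓ)
    have hkm : k < m := Nat.lt_of_succ_lt_succ hℓ
    have hG2 : ∀ c d : ℝ, ∃ v : NNReal,
        Measure.map (fun ω => c * V m ω + d * V k ω) ℙ = gaussianReal 0 v := by
      intro c d
      obtain ⟨v, hv⟩ := hGauss {m, k} (fun j => if j = m then c else d)
      refine ⟨v, ?_⟩
      simpa [Finset.sum_pair hkm.ne', hkm.ne] using hv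
    rw [hrec, harec]
    exact psi_eq_integral_mul (hVmeas m) (hVmeas k) hG2 (ha k) (hvar m) (hvar k)
      (ih m hkm) α hfm
end
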